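/- Let x,y and w,z be two pairs of non-collinear points in a finite generalised quadrangle of order (s,t) with t ≥ 1. If the hyperbolic lines sp(x,y) and sp(w,z) contain two distinct common points, then sp(x,y) = sp(w,z). -/

import Mathlib

/-- A generalised quadrangle: an incidence structure on points `P` and lines `L`
such that two distinct points lie on at most one common line, and the GQ axiom
holds: for every point `x` and line `l` not through `x`, there is exactly one
point on `l` collinear with `x`. -/
structure GenQuad (P L : Type*) where
  incid : P → L → Prop
  unique_line : ∀ ⦃p q : P⦄, p ≠ q → ∀ ⦃l m : L⦄,
    incid p l → incid q l → incid p m → incid q m → l = m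
  gq : ∀ (x : P) (l : L), ¬ incid x l →
    ∃! y : P, incid y l ∧ ∃ m : L, incid x m ∧ incid y m

/-- Two points are collinear if some line is incident with both. -/
def GenQuad.Collin {P L : Type*} (G : GenQuad P L) (x y : P) : Prop :=
  ∃ l : L, G.incid x l ∧ G.incid y l

/-- `B₁(x,y)`: the set of points collinear with both `x` and `y`. -/
def GenQuad.B1pair {P L : Type*} (G : GenQuad P L) (x y : P) : Set P :=
  {z : P | G.Collin z x ∧ G.Collin z y}

/-- The span (hyperbolic line) `sp(x,y) = B₁(B₁(x,y))`: the set of points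
collinear with every point of `B₁(x,y)`. -/
def GenQuad.spanPair {P L : Type*} (G : GenQuad P L) (x y : P) : Set P :=
  {z : P | ∀ w ∈ G.B1pair x y, G.Collin z w}

namespace GenQuad

variable {P L : Type*} (G : GenQuad P L)

theorem Collin.symm {G : GenQuad P L} {x y : P} (h : G.Collin x y) : G.Collin y x :=
  let ⟨l, hx, hy⟩ := h
  ⟨l, hy, hx⟩

/-- There are no triangles: a point collinear with two distinct points of a line lies on it. -/
theorem incid_of_collin {x u v : P} {l : L} (huv : u ≠ v) (hu : G.incid u l)
    (hv : G.incid v l) (hxu : G.Collin x u) (hxv : G.Collin x v) : G.incid x l := by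
  by_contra hx
  exact huv ((G.gq x l hx).unique ⟨hu, hxu⟩ ⟨hv, hxv⟩)

/-- Projecting `y` onto the lines through `x` identifies these lines with the points
collinear with both `x` and `y`. -/
theorem ncard_B1pair {x y : P} (hxy : ¬ G.Collin x y) :
    (G.B1pair x y).ncard = Nat.card {l : L // G.incid x l} := by
  have hy (l : {l : L // G.incid x l}) : ¬ G.incid y l := fun h => hxy ⟨l, l.2, h⟩
  choose f hf hf_unique using fun l => G.gq y _ (hy l)
  let g (l : {l : L // G.incid x l}) : G.B1pair x y :=
    ⟨f l, ⟨l, (hf l).1, l.2⟩, Collin.symm (hf l).2⟩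
  refine (Nat.card_congr (Equiv.ofBijective g ⟨fun l m hlm => ?_, fun p => ?_⟩)).symm
  · have hfe : f l = f m := congrArg Subtype.val hlm
    have hne : f l ≠ x := fun h => hxy (h ▸ Collin.symm (hf l).2)
    exact Subtype.ext (G.unique_line hne (hf l).1 l.2 (hfe ▸ (hf m).1) m.2)
  · obtain ⟨p, ⟨l, hpl, hxl⟩, hpy⟩ := p
    exact ⟨⟨l, hxl⟩, Subtype.ext (hf_unique ⟨l, hxl⟩ p ⟨hpl, hpy.symm⟩).symm⟩

/-- Distinct common neighbours of two non-collinear points are non-collinear. -/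
theorem not_collin_of_mem_B1pair {x y u v : P} (hxy : ¬ G.Collin x y) (huv : u ≠ v)
    (hu : u ∈ G.B1pair x y) (hv : v ∈ G.B1pair x y) : ¬ G.Collin u v := by
  rintro ⟨l, hul, hvl⟩
  exact hxy ⟨l, G.incid_of_collin huv hul hvl hu.1.symm hv.1.symm,
    G.incid_of_collin huv hul hvl hu.2.symm hv.2.symm⟩

/-- Two distinct points of a hyperbolic line have the same common neighbours as the points
spanning it. -/
theorem B1pair_eq_of_mem_spanPair [Finite P] {t : ℕ} (ht : 1 ≤ t)
    (hpoint : ∀ p : P, Nat.card {l : L // G.incid p l} = t + 1)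
    {x y a b : P} (hxy : ¬ G.Collin x y) (hab : a ≠ b)
    (ha : a ∈ G.spanPair x y) (hb : b ∈ G.spanPair x y) :
    G.B1pair x y = G.B1pair a b := by
  have hcard : (G.B1pair x y).ncard = t + 1 := (G.ncard_B1pair hxy).trans (hpoint x)
  obtain ⟨u, hu, v, hv, huv⟩ :=
    (Set.one_lt_ncard (Set.toFinite (G.B1pair x y))).1 (by omega)
  have hnab : ¬ G.Collin a b := by
    rintro ⟨l, hal, hbl⟩
    exact G.not_collin_of_mem_B1pair hxy huv hu hv
      ⟨l, G.incid_of_collin hab hal hbl (ha u hu).symm (hb u hu).symm,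
        G.incid_of_collin hab hal hbl (ha v hv).symm (hb v hv).symm⟩
  refine Set.eq_of_subset_of_ncard_le (fun p hp => ⟨(ha p hp).symm, (hb p hp).symm⟩) ?_
    (Set.toFinite _)
  rw [hcard, G.ncard_B1pair hnab, hpoint a]

end GenQuad

/-- In a finite generalised quadrangle of order `(s,t)` with `t ≥ 1`, if the
hyperbolic lines `sp(x,y)` and `sp(w,z)` of two pairs of non-collinear points
share two distinct points, then they are equal. -/
theorem gq_hyperbolic_lines_eq {P L : Type*} [Finite P] [Finite L]
    (G : GenQuad P L) (s t : ℕ) (ht : 1 ≤ t)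
    (hline : ∀ l : L, Nat.card {p : P // G.incid p l} = s + 1)
    (hpoint : ∀ p : P, Nat.card {l : L // G.incid p l} = t + 1)
    (x y w z : P) (hxy : ¬ G.Collin x y) (hwz : ¬ G.Collin w z)
    (a b : P) (hab : a ≠ b)
    (haxy : a ∈ G.spanPair x y) (hawz : a ∈ G.spanPair w z)
    (hbxy : b ∈ G.spanPair x y) (hbwz : b ∈ G.spanPair w z) :
    G.spanPair x y = G.spanPair w z := by
  unfold GenQuad.spanPair
  rw [G.B1pair_eq_of_mem_spanPair ht hpoint hxy hab haxy hbxy,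
    G.B1pair_eq_of_mem_spanPair ht hpoint hwz hab hawz hbwz]
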